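/- arXiv:2412.05239 — 6 statements merged into one kernel-verified Lean document; each statement's English description precedes it below -/
import Mathlib

section
/- Let S be a measurable space, let dist be a pseudometric on the set P(S) of probability measures on S, and let (p_t)_{t≥0} and (p_t^δ)_{t≥0} be two transition semigroups on S. Fix constants λ > 0, τ > 0, α > 0, δ > 0, a function M : P(S) → [0,∞), and a probability measure ν with a constant C(ν) ≥ 0. Assume: (1) contractivity: dist(μ p_t, η p_t) ≤ e^{-λ t} · dist(μ, η) for all probability measures μ, η on S and all t ≥ 0; (2) finite time convergence: dist(μ p_t, μ p_t^δ) ≤ δ^α · M(μ) for all probability measures μ on S and all 0 ≤ t ≤ τ; (3) uniform control: M(ν p_{iτ}^δ) ≤ C(ν) for all i ∈ ℕ. Then for every k ∈ ℕ, dist(ν p_{kτ}, ν p_{kτ}^δ) ≤ δ^α · C(ν) / (1 − e^{-λτ}). -/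
open MeasureTheory Real

/-- Uniform-in-time convergence (informal Theorem 1 of the paper):
contractivity of `p`, finite time convergence between `p` and `pδ`, and
uniform control of `M` along the approximated dynamics imply a uniform-in-time
bound at all times `k * τ`. -/
theorem uniform_in_time_convergence
    {S : Type*} [MeasurableSpace S]
    (d : ProbabilityMeasure S → ProbabilityMeasure S → ℝ)
    (hd_nonneg : ∀ μ η, 0 ≤ d μ η)
    (hd_symm : ∀ μ η, d μ η = d η μ)
    (hd_triangle : ∀ μ η ρ, d μ ρ ≤ d μ η + d η ρ)
    (p pδ : ℝ → ProbabilityMeasure S → ProbabilityMeasure S)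
    (hp_zero : ∀ μ, p 0 μ = μ)
    (hp_add : ∀ s t, 0 ≤ s → 0 ≤ t → ∀ μ, p (s + t) μ = p t (p s μ))
    (hpδ_zero : ∀ μ, pδ 0 μ = μ)
    (hpδ_add : ∀ s t, 0 ≤ s → 0 ≤ t → ∀ μ, pδ (s + t) μ = pδ t (pδ s μ))
    (lam τ α δ : ℝ) (hlam : 0 < lam) (hτ : 0 < τ) (hα : 0 < α) (hδ : 0 < δ)
    (M : ProbabilityMeasure S → ℝ) (hM : ∀ μ, 0 ≤ M μ)
    (ν : ProbabilityMeasure S) (Cν : ℝ) (hCν : 0 ≤ Cν)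
    (hcontract : ∀ μ η : ProbabilityMeasure S, ∀ t : ℝ, 0 ≤ t →
      d (p t μ) (p t η) ≤ Real.exp (-lam * t) * d μ η)
    (hfinite : ∀ μ : ProbabilityMeasure S, ∀ t : ℝ, 0 ≤ t → t ≤ τ →
      d (p t μ) (pδ t μ) ≤ δ ^ α * M μ)
    (huniform : ∀ i : ℕ, M (pδ (i * τ) ν) ≤ Cν) :
    ∀ k : ℕ, d (p (k * τ) ν) (pδ (k * τ) ν) ≤ δ ^ α * Cν / (1 - Real.exp (-lam * τ)) := by
  have hr1 : Real.exp (-lam * τ) < 1 := Real.exp_lt_one_iff.mpr (by nlinarith)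
  have hr0 : 0 < Real.exp (-lam * τ) := Real.exp_pos _
  set r := Real.exp (-lam * τ)
  have hδα : 0 ≤ δ ^ α := Real.rpow_nonneg hδ.le α
  have hlocal : ∀ i : ℕ, ∀ t : ℝ, 0 ≤ t → t ≤ τ →
      d (p t (pδ (i * τ) ν)) (pδ t (pδ (i * τ) ν)) ≤ δ ^ α * Cν := fun i t h0 h1 =>
    (hfinite _ t h0 h1).trans (mul_le_mul_of_nonneg_left (huniform i) hδα)
  have hfix : δ ^ α * Cν / (1 - r) = r * (δ ^ α * Cν / (1 - r)) + δ ^ α * Cν := by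
    have : 1 - r ≠ 0 := (sub_pos.mpr hr1).ne'
    field_simp
    ring
  have hbound : 0 ≤ δ ^ α * Cν / (1 - r) :=
    div_nonneg (mul_nonneg hδα hCν) (sub_pos.mpr hr1).le
  intro k
  induction k with
  | zero =>
    have h := hlocal 0 0 le_rfl hτ.le
    simp only [Nat.cast_zero, zero_mul, hp_zero, hpδ_zero] at h ⊢
    rw [hfix]
    exact h.trans (le_add_of_nonneg_left (mul_nonneg hr0.le hbound))
  | succ k ih =>
    have hk : (0 : ℝ) ≤ k * τ := by positivity
    rw [Nat.cast_succ, add_one_mul, hp_add _ _ hk hτ.le, hpδ_add _ _ hk hτ.le, hfix]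
    calc d (p τ (p (k * τ) ν)) (pδ τ (pδ (k * τ) ν))
        ≤ d (p τ (p (k * τ) ν)) (p τ (pδ (k * τ) ν))
          + d (p τ (pδ (k * τ) ν)) (pδ τ (pδ (k * τ) ν)) := hd_triangle _ _ _
      _ ≤ r * (δ ^ α * Cν / (1 - r)) + δ ^ α * Cν :=
        add_le_add
          ((hcontract _ _ τ hτ.le).trans (mul_le_mul_of_nonneg_left ih hr0.le))
          (hlocal k τ hτ.le le_rfl)
end

section
/- Let S be a measurable space, let dist be a pseudometric on the set P(S) of probability measures on S, and let (p_t)_{t≥0} and (p_t^δ)_{t≥0} be two transition semigroups on S. Fix constants λ > 0, τ > 0, δ > 0, a function g : (0,∞) → [0,∞), a function M : P(S) → [0,∞), and a probability measure ν with a constant C(ν) ≥ 0. Assume: (1) contractivity: dist(μ p_t, η p_t) ≤ e^{-λ t} · dist(μ, η) for all probability measures μ, η on S and all t ≥ 0; (2) finite time convergence with modulus g: dist(μ p_t, μ p_t^δ) ≤ g(δ) · M(μ) for all probability measures μ on S and all 0 ≤ t ≤ τ; (3) uniform control: M(ν p_{iτ}^δ) ≤ C(ν) for all i ∈ ℕ.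 Then for every k ∈ ℕ, dist(ν p_{kτ}, ν p_{kτ}^δ) ≤ g(δ) · C(ν) / (1 − e^{-λτ}). -/
open MeasureTheory Real

/-- Uniform-in-time convergence with a general modulus `g` in place of `δ^α`. -/
theorem uniform_in_time_convergence_general_modulus
    {S : Type*} [MeasurableSpace S]
    (d : ProbabilityMeasure S → ProbabilityMeasure S → ℝ)
    (hd_nonneg : ∀ μ η, 0 ≤ d μ η)
    (hd_symm : ∀ μ η, d μ η = d η μ)
    (hd_triangle : ∀ μ η ρ, d μ ρ ≤ d μ η + d η ρ)
    (p pδ : ℝ → ProbabilityMeasure S → ProbabilityMeasure S)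
    (hp_zero : ∀ μ, p 0 μ = μ)
    (hp_add : ∀ s t, 0 ≤ s → 0 ≤ t → ∀ μ, p (s + t) μ = p t (p s μ))
    (hpδ_zero : ∀ μ, pδ 0 μ = μ)
    (hpδ_add : ∀ s t, 0 ≤ s → 0 ≤ t → ∀ μ, pδ (s + t) μ = pδ t (pδ s μ))
    (lam τ δ : ℝ) (hlam : 0 < lam) (hτ : 0 < τ) (hδ : 0 < δ)
    (g : ℝ → ℝ) (hg_nonneg : ∀ x : ℝ, 0 < x → 0 ≤ g x)
    (M : ProbabilityMeasure S → ℝ) (hM : ∀ μ, 0 ≤ M μ)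
    (ν : ProbabilityMeasure S) (Cν : ℝ) (hCν : 0 ≤ Cν)
    (hcontract : ∀ μ η : ProbabilityMeasure S, ∀ t : ℝ, 0 ≤ t →
      d (p t μ) (p t η) ≤ Real.exp (-lam * t) * d μ η)
    (hfinite : ∀ μ : ProbabilityMeasure S, ∀ t : ℝ, 0 ≤ t → t ≤ τ →
      d (p t μ) (pδ t μ) ≤ g δ * M μ)
    (huniform : ∀ i : ℕ, M (pδ (i * τ) ν) ≤ Cν) :
    ∀ k : ℕ, d (p (k * τ) ν) (pδ (k * τ) ν) ≤ g δ * Cν / (1 - Real.exp (-lam * τ)) := by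
  have hr_lt : Real.exp (-lam * τ) < 1 :=
    Real.exp_lt_one_iff.mpr (by nlinarith [mul_pos hlam hτ])
  have hr_pos : 0 < 1 - Real.exp (-lam * τ) := sub_pos.mpr hr_lt
  have hg : 0 ≤ g δ := hg_nonneg δ hδ
  have hfix : Real.exp (-lam * τ) * (g δ * Cν / (1 - Real.exp (-lam * τ))) + g δ * Cν
      = g δ * Cν / (1 - Real.exp (-lam * τ)) := by
    generalize Real.exp (-lam * τ) = r at hr_pos ⊢
    field_simp
    ring
  have hB : 0 ≤ g δ * Cν / (1 - Real.exp (-lam * τ)) := by positivity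
  have hlocal (i : ℕ) (t : ℝ) (ht : 0 ≤ t) (htτ : t ≤ τ) :
      d (p t (pδ (i * τ) ν)) (pδ t (pδ (i * τ) ν)) ≤ g δ * Cν :=
    (hfinite _ t ht htτ).trans (mul_le_mul_of_nonneg_left (huniform i) hg)
  intro k
  induction k with
  | zero =>
    have h := hlocal 0 0 le_rfl hτ.le
    simp only [Nat.cast_zero, zero_mul, hp_zero, hpδ_zero] at h ⊢
    linarith [mul_nonneg (Real.exp_pos (-lam * τ)).le hB]
  | succ k ih =>
    have hk : 0 ≤ (k : ℝ) * τ := by positivity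
    rw [Nat.cast_succ, add_one_mul, hp_add _ _ hk hτ.le, hpδ_add _ _ hk hτ.le]
    calc d (p τ (p (k * τ) ν)) (pδ τ (pδ (k * τ) ν))
        ≤ d (p τ (p (k * τ) ν)) (p τ (pδ (k * τ) ν))
          + d (p τ (pδ (k * τ) ν)) (pδ τ (pδ (k * τ) ν)) := hd_triangle _ _ _
      _ ≤ Real.exp (-lam * τ) * (g δ * Cν / (1 - Real.exp (-lam * τ))) + g δ * Cν :=
          add_le_add
            ((hcontract _ _ τ hτ.le).trans (mul_le_mul_of_nonneg_left ih (Real.exp_pos _).le))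
            (hlocal k τ hτ.le le_rfl)
      _ = g δ * Cν / (1 - Real.exp (-lam * τ)) := hfix
end

section
/- Let dist be a pseudometric on the set P(ℝ^n) of probability measures on ℝ^n. Let (p̄_t)_{t≥0} be a transition semigroup on ℝ^n (the averaged process) and let (p_t^δ)_{t≥0} be a transition semigroup on ℝ^n × ℝ^d (the slow–fast process). For a probability measure ν on ℝ^n × ℝ^d write ν^x for its first marginal, i.e. the pushforward of ν under the projection (x,y) ↦ x. Fix constants λ > 0, C < ∞, τ > 0, α > 0, δ > 0, a function M : P(ℝ^n × ℝ^d) → [0,∞), a probability measure ν on ℝ^n × ℝ^d, and a constant C(ν) ≥ 0. Assume: (1) contractivity for the limit process: dist(μ p̄_t, η p̄_t) ≤ C e^{-λ t} · dist(μ, η) for all probability measures μ, η on ℝ^n and all t ≥ 0; (2) finite time convergence: dist(μ^x p̄_t, (μ p_t^δ)^x) ≤ δ^α · M(μ) for all probability measures μ on ℝ^n × ℝ^d and all 0 ≤ t ≤ τ; (3) uniform bound for the coupled process: M(ν p_t^δ) ≤ C(ν) for all t ≥ 0. Then for every t ≥ 0, dist(ν^x p̄_t, (ν p_t^δ)^x)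 ≤ δ^α · C(ν) · (1 + C/(1 − e^{-λτ})). -/
open MeasureTheory Real

/-- The first marginal of a probability measure on a product space. -/
noncomputable def firstMarginal {X Y : Type*} [MeasurableSpace X] [MeasurableSpace Y]
    (ν : ProbabilityMeasure (X × Y)) : ProbabilityMeasure X :=
  ν.map (f := Prod.fst) measurable_fst.aemeasurable

/-- Uniform-in-time convergence for the method of averaging (Theorem `thm:avg_meas`):
contractivity of the averaged semigroup, finite time convergence of the first marginal of
the slow-fast system to the averaged system, and uniform control of `M` along the coupled
dynamics imply a uniform-in-time bound. -/
theorem uniform_in_time_averaging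
    {n dd : ℕ}
    (d : ProbabilityMeasure (Fin n → ℝ) → ProbabilityMeasure (Fin n → ℝ) → ℝ)
    (hd_nonneg : ∀ μ η, 0 ≤ d μ η)
    (hd_symm : ∀ μ η, d μ η = d η μ)
    (hd_triangle : ∀ μ η ρ, d μ ρ ≤ d μ η + d η ρ)
    (pbar : ℝ → ProbabilityMeasure (Fin n → ℝ) → ProbabilityMeasure (Fin n → ℝ))
    (hpbar_zero : ∀ μ, pbar 0 μ = μ)
    (hpbar_add : ∀ s t, 0 ≤ s → 0 ≤ t → ∀ μ, pbar (s + t) μ = pbar t (pbar s μ))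
    (pδ : ℝ → ProbabilityMeasure ((Fin n → ℝ) × (Fin dd → ℝ)) →
      ProbabilityMeasure ((Fin n → ℝ) × (Fin dd → ℝ)))
    (hpδ_zero : ∀ μ, pδ 0 μ = μ)
    (hpδ_add : ∀ s t, 0 ≤ s → 0 ≤ t → ∀ μ, pδ (s + t) μ = pδ t (pδ s μ))
    (lam C τ α δ : ℝ) (hlam : 0 < lam) (hC : 0 ≤ C) (hτ : 0 < τ) (hα : 0 < α) (hδ : 0 < δ)
    (M : ProbabilityMeasure ((Fin n → ℝ) × (Fin dd → ℝ)) → ℝ) (hM : ∀ μ, 0 ≤ M μ)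
    (ν : ProbabilityMeasure ((Fin n → ℝ) × (Fin dd → ℝ))) (Cν : ℝ) (hCν : 0 ≤ Cν)
    (hcontract : ∀ μ η : ProbabilityMeasure (Fin n → ℝ), ∀ t : ℝ, 0 ≤ t →
      d (pbar t μ) (pbar t η) ≤ C * Real.exp (-lam * t) * d μ η)
    (hfinite : ∀ μ : ProbabilityMeasure ((Fin n → ℝ) × (Fin dd → ℝ)), ∀ t : ℝ, 0 ≤ t → t ≤ τ →
      d (pbar t (firstMarginal μ)) (firstMarginal (pδ t μ)) ≤ δ ^ α * M μ)
    (huniform : ∀ t : ℝ, 0 ≤ t → M (pδ t ν) ≤ Cν) :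
    ∀ t : ℝ, 0 ≤ t →
      d (pbar t (firstMarginal ν)) (firstMarginal (pδ t ν)) ≤
        δ ^ α * Cν * (1 + C / (1 - Real.exp (-lam * τ))) := by
  have hK : 0 ≤ δ ^ α * Cν := mul_nonneg (rpow_nonneg hδ.le α) hCν
  have hδα : 0 ≤ δ ^ α := rpow_nonneg hδ.le α
  set q := Real.exp (-lam * τ) with hq
  have hq0 : 0 ≤ q := (Real.exp_pos _).le
  have hq1 : q < 1 := by
    rw [hq, Real.exp_lt_one_iff]
    nlinarith [mul_pos hlam hτ]
  have partial_bound : ∀ N : ℕ, ∀ μ : ProbabilityMeasure ((Fin n → ℝ) × (Fin dd → ℝ)),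
      (∀ t : ℝ, 0 ≤ t → M (pδ t μ) ≤ Cν) → ∀ t : ℝ, N * τ ≤ t → t ≤ (N + 1) * τ →
        d (pbar t (firstMarginal μ)) (firstMarginal (pδ t μ)) ≤
          δ ^ α * Cν * (1 + C * ∑ k ∈ Finset.range N, q ^ k) := by
    intro N
    induction N with
    | zero =>
      intro μ hμ t ht htτ
      have hM0 : M μ ≤ Cν := by simpa [hpδ_zero] using hμ 0 le_rfl
      simpa using (hfinite μ t (by simpa using ht) (by simpa using htτ)).trans
        (mul_le_mul_of_nonneg_left hM0 hδα)
    | succ N ih =>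
      intro μ hμ t ht htτ
      push_cast at ht htτ
      have hs : N * τ ≤ t - τ := by linarith
      have hs0 : 0 ≤ t - τ := le_trans (by positivity) hs
      have hsplit : t = τ + (t - τ) := by ring
      have hM0 : M μ ≤ Cν := by simpa [hpδ_zero] using hμ 0 le_rfl
      have hfirst : d (pbar τ (firstMarginal μ)) (firstMarginal (pδ τ μ)) ≤ δ ^ α * Cν :=
        (hfinite μ τ hτ.le le_rfl).trans (mul_le_mul_of_nonneg_left hM0 hδα)
      have hexp : Real.exp (-lam * (t - τ)) ≤ q ^ N := by
        rw [hq, ← Real.exp_nat_mul, Real.exp_le_exp]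
        nlinarith [mul_le_mul_of_nonneg_left hs hlam.le]
      have hcoupled := ih (pδ τ μ)
        (fun u hu => by simpa [hpδ_add τ u hτ.le hu] using hμ (τ + u) (by linarith))
        (t - τ) hs (by linarith)
      have hdamped : d (pbar (t - τ) (pbar τ (firstMarginal μ)))
          (pbar (t - τ) (firstMarginal (pδ τ μ))) ≤ C * q ^ N * (δ ^ α * Cν) :=
        (hcontract _ _ _ hs0).trans (mul_le_mul (mul_le_mul_of_nonneg_left hexp hC) hfirst
          (hd_nonneg _ _) (mul_nonneg hC (pow_nonneg hq0 N)))
      rw [hsplit, hpbar_add τ (t - τ) hτ.le hs0, hpδ_add τ (t - τ) hτ.le hs0,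
        Finset.sum_range_succ]
      linarith [hd_triangle (pbar (t - τ) (pbar τ (firstMarginal μ)))
        (pbar (t - τ) (firstMarginal (pδ τ μ))) (firstMarginal (pδ (t - τ) (pδ τ μ)))]
  intro t ht
  have hfloor : (⌊t / τ⌋₊ : ℝ) * τ ≤ t :=
    (le_div_iff₀ hτ).mp (Nat.floor_le (div_nonneg ht hτ.le))
  have hceil : t ≤ ((⌊t / τ⌋₊ : ℝ) + 1) * τ :=
    ((div_lt_iff₀ hτ).mp (Nat.lt_floor_add_one (t / τ))).le
  refine (partial_bound ⌊t / τ⌋₊ ν huniform t hfloor hceil).trans ?_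
  rw [div_eq_mul_inv C, ← tsum_geometric_of_lt_one hq0 hq1]
  gcongr
  exact (summable_geometric_of_lt_one hq0 hq1).sum_le_tsum _ (fun k _ => pow_nonneg hq0 k)
end

section
/- Let dist be a pseudometric on the set P(ℝ^d) of probability measures on ℝ^d. Let (p_t)_{t≥0} be a transition semigroup on ℝ^d (the continuous dynamics) and let π_δ : P(ℝ^d) → P(ℝ^d) be a single map (one step of the numerical scheme with step size δ), with iterates π_δ^l. Suppose δ > 0 satisfies 1/δ ∈ ℕ. Fix constants λ > 0, C < ∞, α > 0, a function M : P(ℝ^d) → [0,∞), a probability measure ν on ℝ^d, and a constant C(ν) ≥ 0. Assume: (1) contractivity of the continuous dynamics: dist(μ p_t, η p_t) ≤ C e^{-λ t} · dist(μ, η) for all probability measures μ, η on ℝ^d and all t ≥ 0; (2) local error bound: dist(μ p_{δl}, μ π_δ^l) ≤ δ^α · M(μ) for all probability measures μ on ℝ^d and all l ∈ ℕ with lδ ≤ 1; (3) uniform control for the approximated dynamics: M(ν π_δ^l) ≤ C(ν) for all l ∈ ℕ. Then for every l ∈ ℕ, dist(ν π_δ^l, ν p_{δl}) ≤ δ^α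 · C(ν) · (C/(1 − e^{-λ}) + 1). -/
open MeasureTheory Real

/-- Contracting errors of size `K`, one per unit of time, add up to at most a geometric series.
`q` is the discrete dynamics over one unit of time. The distance of a point to itself is not
assumed to vanish, so the induction starts after one step. -/
theorem dist_contracted_iterate_le {S : Type*} {d : S → S → ℝ}
    (hd_triangle : ∀ μ η ρ, d μ ρ ≤ d μ η + d η ρ)
    {p : ℝ → S → S}
    (hp_add : ∀ s t, 0 ≤ s → 0 ≤ t → ∀ μ, p (s + t) μ = p t (p s μ))
    {lam C K : ℝ} (hlam : 0 < lam) (hC : 0 ≤ C) (hK : 0 ≤ K)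
    (hcontract : ∀ μ η, ∀ t : ℝ, 0 ≤ t → d (p t μ) (p t η) ≤ C * Real.exp (-lam * t) * d μ η)
    {q : S → S} {ν : S} (hstep : ∀ k : ℕ, d (q^[k + 1] ν) (p 1 (q^[k] ν)) ≤ K)
    (k : ℕ) {s : ℝ} (hs : 0 ≤ s) :
    d (p s (q^[k + 1] ν)) (p ((k + 1 : ℕ) + s) ν)
      ≤ K * (C / (1 - Real.exp (-lam))) * Real.exp (-lam * s) := by
  have hlt : Real.exp (-lam) < 1 := Real.exp_lt_one_iff.mpr (by linarith)
  have hpos : 0 < 1 - Real.exp (-lam) := by linarith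
  have hone : ∀ (j : ℕ) {t : ℝ}, 0 ≤ t →
      d (p t (q^[j + 1] ν)) (p (1 + t) (q^[j] ν)) ≤ C * Real.exp (-lam * t) * K := by
    intro j t ht
    rw [hp_add 1 t zero_le_one ht]
    exact (hcontract _ _ t ht).trans (mul_le_mul_of_nonneg_left (hstep j) (by positivity))
  have hgeom : ∀ t : ℝ, C * Real.exp (-lam * t) * K
      + K * (C / (1 - Real.exp (-lam))) * Real.exp (-lam * (1 + t))
      = K * (C / (1 - Real.exp (-lam))) * Real.exp (-lam * t) := by
    intro t
    rw [show -lam * (1 + t) = -lam + -lam * t by ring, Real.exp_add]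
    field_simp
    ring
  induction k generalizing s with
  | zero =>
    have h := hone 0 hs
    have hnonneg : 0 ≤ K * (C / (1 - Real.exp (-lam))) * Real.exp (-lam * (1 + s)) := by
      positivity
    simp only [zero_add, Nat.cast_one, Function.iterate_zero, id_eq] at h ⊢
    linarith [hgeom s]
  | succ k ih =>
    have h := ih (s := 1 + s) (by linarith)
    rw [show ((k + 1 : ℕ) : ℝ) + (1 + s) = ((k + 1 + 1 : ℕ) : ℝ) + s by push_cast; ring] at h
    linarith [hd_triangle (p s (q^[k + 1 + 1] ν)) (p (1 + s) (q^[k + 1] ν))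
      (p ((k + 1 + 1 : ℕ) + s) ν), hone (k + 1) hs, hgeom s]

/-- Uniform-in-time convergence for numerical discretisations (Theorem `thm:uit_num`):
contractivity of the continuous dynamics, a local error bound over one unit of time,
and uniform control of `M` along the discretised dynamics imply a uniform-in-time bound. -/
theorem uniform_in_time_numerical_discretisation
    {dd : ℕ}
    (d : ProbabilityMeasure (Fin dd → ℝ) → ProbabilityMeasure (Fin dd → ℝ) → ℝ)
    (hd_nonneg : ∀ μ η, 0 ≤ d μ η)
    (hd_symm : ∀ μ η, d μ η = d η μ)
    (hd_triangle : ∀ μ η ρ, d μ ρ ≤ d μ η + d η ρ)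
    (p : ℝ → ProbabilityMeasure (Fin dd → ℝ) → ProbabilityMeasure (Fin dd → ℝ))
    (hp_zero : ∀ μ, p 0 μ = μ)
    (hp_add : ∀ s t, 0 ≤ s → 0 ≤ t → ∀ μ, p (s + t) μ = p t (p s μ))
    (πδ : ProbabilityMeasure (Fin dd → ℝ) → ProbabilityMeasure (Fin dd → ℝ))
    (δ : ℝ) (hδ : 0 < δ) (hδ_inv : ∃ m : ℕ, (m : ℝ) = 1 / δ)
    (lam C α : ℝ) (hlam : 0 < lam) (hC : 0 ≤ C) (hα : 0 < α)
    (M : ProbabilityMeasure (Fin dd → ℝ) → ℝ) (hM : ∀ μ, 0 ≤ M μ)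
    (ν : ProbabilityMeasure (Fin dd → ℝ)) (Cν : ℝ) (hCν : 0 ≤ Cν)
    (hcontract : ∀ μ η : ProbabilityMeasure (Fin dd → ℝ), ∀ t : ℝ, 0 ≤ t →
      d (p t μ) (p t η) ≤ C * Real.exp (-lam * t) * d μ η)
    (hlocal : ∀ μ : ProbabilityMeasure (Fin dd → ℝ), ∀ l : ℕ, (l : ℝ) * δ ≤ 1 →
      d (p (δ * l) μ) (πδ^[l] μ) ≤ δ ^ α * M μ)
    (huniform : ∀ l : ℕ, M (πδ^[l] ν) ≤ Cν) :
    ∀ l : ℕ, d (πδ^[l] ν) (p (δ * l) ν) ≤ δ ^ α * Cν * (C / (1 - Real.exp (-lam)) + 1) := by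
  intro l
  obtain ⟨m, hm⟩ := hδ_inv
  have hmδ : δ * m = 1 := by rw [hm]; field_simp
  have hm_pos : 0 < m := Nat.pos_of_ne_zero (by rintro rfl; simp at hmδ)
  have hδα : 0 ≤ δ ^ α := by positivity
  have hK : 0 ≤ δ ^ α * Cν := by positivity
  have hlocal' : ∀ j r : ℕ, r ≤ m →
      d (πδ^[r + j] ν) (p (δ * r) (πδ^[j] ν)) ≤ δ ^ α * Cν := by
    intro j r hr
    have hrδ : (r : ℝ) * δ ≤ 1 := by
      rw [← hmδ, mul_comm]
      gcongr
    rw [Function.iterate_add_apply, hd_symm]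
    exact (hlocal _ r hrδ).trans (mul_le_mul_of_nonneg_left (huniform j) hδα)
  have hlt : Real.exp (-lam) < 1 := Real.exp_lt_one_iff.mpr (by linarith)
  have hgeom_nonneg : 0 ≤ C / (1 - Real.exp (-lam)) := div_nonneg hC (by linarith)
  have hprod_nonneg := mul_nonneg hK hgeom_nonneg
  obtain ⟨n, r, hr, rfl⟩ : ∃ n r, r < m ∧ r + m * n = l :=
    ⟨l / m, l % m, Nat.mod_lt _ hm_pos, Nat.mod_add_div l m⟩
  have hlast := hlocal' (m * n) r hr.le
  rw [mul_add, mul_one]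
  cases n with
  | zero =>
    simp only [mul_zero, add_zero, Function.iterate_zero, id_eq] at hlast ⊢
    linarith
  | succ k =>
    have hs : 0 ≤ δ * (r : ℝ) := by positivity
    have hstep : ∀ j : ℕ, d ((πδ^[m])^[j + 1] ν) (p 1 ((πδ^[m])^[j] ν)) ≤ δ ^ α * Cν := by
      intro j
      have h := hlocal' (m * j) m le_rfl
      rw [hmδ] at h
      rwa [← Function.iterate_mul, ← Function.iterate_mul, Nat.mul_succ, add_comm]
    have h := dist_contracted_iterate_le hd_triangle hp_add hlam hC hK hcontract hstep k hs
    rw [← Function.iterate_mul] at h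
    have htime : δ * ((r + m * (k + 1) : ℕ) : ℝ) = ((k + 1 : ℕ) : ℝ) + δ * r := by
      push_cast
      linear_combination ((k : ℝ) + 1) * hmδ
    have hexp : Real.exp (-lam * (δ * r)) ≤ 1 := Real.exp_le_one_iff.mpr (by nlinarith)
    rw [htime]
    linarith [hd_triangle (πδ^[r + m * (k + 1)] ν) (p (δ * r) (πδ^[m * (k + 1)] ν))
      (p ((k + 1 : ℕ) + δ * r) ν), mul_le_of_le_one_right hprod_nonneg hexp]
end

section
/- Fix N ∈ ℕ, N ≥ 1. Let dist be a pseudometric on the set P((ℝ^d)^N) of probability measures on the N-fold product (ℝ^d)^N. Let (p_t^N)_{t≥0} be a transition semigroup on (ℝ^d)^N (the mean-field N-particle system) and let (p̄_t)_{t≥0} be a transition semigroup on ℝ^d (one component of the limiting process). For a probability measure μ on ℝ^d, write μ^{⊗N} for the N-fold product measure on (ℝ^d)^N. Fix constants λ > 0, C < ∞, τ > 0, α > 0, a function M : P(ℝ^d) → [0,∞), a probability measure ν on ℝ^d, and a constant C(ν) ≥ 0. Assume: (1) contractivity for the mean-field particle system: dist(μ p_t^N, η p_t^N) ≤ C e^{-λ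 t} · dist(μ, η) for all probability measures μ, η on (ℝ^d)^N and all t ≥ 0; (2) finite time propagation of chaos: dist(μ^{⊗N} p_t^N, (μ p̄_t)^{⊗N}) ≤ N^{-α} · M(μ) for all probability measures μ on ℝ^d and all 0 ≤ t ≤ τ; (3) uniform control for the limit process: M(ν p̄_t) ≤ C(ν) for all t ≥ 0. Then for every t ≥ 0, dist((ν p̄_t)^{⊗N}, ν^{⊗N} p_t^N) ≤ 2 C C(ν) N^{-α} / (1 − e^{-λτ}). -/
open MeasureTheory Real

/-- The `N`-fold product `μ^{⊗N}` of a probability measure. -/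
noncomputable def productMeasure {X : Type*} [MeasurableSpace X] (N : ℕ)
    (μ : ProbabilityMeasure X) : ProbabilityMeasure (Fin N → X) :=
  ⟨Measure.pi fun _ => (μ : Measure X), inferInstance⟩

/-- Uniform-in-time propagation of chaos (Theorem `thm:mf_meas`): contractivity of the
mean-field `N`-particle system, finite time propagation of chaos, and uniform control of
`M` along the limit process imply a uniform-in-time propagation of chaos bound. -/
theorem uniform_in_time_propagation_of_chaos
    {dd : ℕ} (N : ℕ) (hN : 1 ≤ N)
    (d : ProbabilityMeasure (Fin N → (Fin dd → ℝ)) →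
      ProbabilityMeasure (Fin N → (Fin dd → ℝ)) → ℝ)
    (hd_nonneg : ∀ μ η, 0 ≤ d μ η)
    (hd_symm : ∀ μ η, d μ η = d η μ)
    (hd_triangle : ∀ μ η ρ, d μ ρ ≤ d μ η + d η ρ)
    (pN : ℝ → ProbabilityMeasure (Fin N → (Fin dd → ℝ)) →
      ProbabilityMeasure (Fin N → (Fin dd → ℝ)))
    (hpN_zero : ∀ μ, pN 0 μ = μ)
    (hpN_add : ∀ s t, 0 ≤ s → 0 ≤ t → ∀ μ, pN (s + t) μ = pN t (pN s μ))
    (pbar : ℝ → ProbabilityMeasure (Fin dd → ℝ) → ProbabilityMeasure (Fin dd → ℝ))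
    (hpbar_zero : ∀ μ, pbar 0 μ = μ)
    (hpbar_add : ∀ s t, 0 ≤ s → 0 ≤ t → ∀ μ, pbar (s + t) μ = pbar t (pbar s μ))
    (lam C τ α : ℝ) (hlam : 0 < lam) (hC : 0 ≤ C) (hτ : 0 < τ) (hα : 0 < α)
    (M : ProbabilityMeasure (Fin dd → ℝ) → ℝ) (hM : ∀ μ, 0 ≤ M μ)
    (ν : ProbabilityMeasure (Fin dd → ℝ)) (Cν : ℝ) (hCν : 0 ≤ Cν)
    (hcontract : ∀ μ η : ProbabilityMeasure (Fin N → (Fin dd → ℝ)), ∀ t : ℝ, 0 ≤ t →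
      d (pN t μ) (pN t η) ≤ C * Real.exp (-lam * t) * d μ η)
    (hfinite : ∀ μ : ProbabilityMeasure (Fin dd → ℝ), ∀ t : ℝ, 0 ≤ t → t ≤ τ →
      d (pN t (productMeasure N μ)) (productMeasure N (pbar t μ)) ≤ (N : ℝ) ^ (-α) * M μ)
    (huniform : ∀ t : ℝ, 0 ≤ t → M (pbar t ν) ≤ Cν) :
    ∀ t : ℝ, 0 ≤ t →
      d (productMeasure N (pbar t ν)) (pN t (productMeasure N ν)) ≤
        2 * C * Cν * (N : ℝ) ^ (-α) / (1 - Real.exp (-lam * τ)) := by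
  intro t ht
  have hq_pos : 0 < Real.exp (-lam * τ) := Real.exp_pos _
  have hq_lt : Real.exp (-lam * τ) < 1 := by
    rw [Real.exp_lt_one_iff]
    nlinarith [mul_pos hlam hτ]
  have hN_pow : 0 ≤ (N : ℝ) ^ (-α) := Real.rpow_nonneg (Nat.cast_nonneg N) _
  have hbound_nonneg : 0 ≤ 2 * C * Cν * (N : ℝ) ^ (-α) / (1 - Real.exp (-lam * τ)) :=
    div_nonneg (by positivity) (by linarith)
  rcases lt_or_ge C 1 with hC1 | hC1
  · -- A contraction constant below one forces the pseudometric to vanish.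
    have h := hcontract (productMeasure N (pbar t ν)) (pN t (productMeasure N ν)) 0 le_rfl
    rw [hpN_zero, hpN_zero, mul_zero, Real.exp_zero, mul_one] at h
    nlinarith
  set a : ℝ := (N : ℝ) ^ (-α) * Cν with ha
  have ha_nonneg : 0 ≤ a := mul_nonneg hN_pow hCν
  have hshort : ∀ s r : ℝ, 0 ≤ s → 0 ≤ r → r ≤ τ →
      d (pN r (productMeasure N (pbar s ν))) (productMeasure N (pbar r (pbar s ν))) ≤ a :=
    fun s r hs hr hrτ => (hfinite _ r hr hrτ).trans
      (mul_le_mul_of_nonneg_left (huniform s hs) hN_pow)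
  have hgeom : ∀ k : ℕ, ∀ s r : ℝ, 0 ≤ s → 0 ≤ r → r ≤ τ →
      d (pN (r + k * τ) (productMeasure N (pbar s ν)))
        (productMeasure N (pbar (r + k * τ) (pbar s ν))) ≤
        C * a * ∑ i ∈ Finset.range (k + 1), Real.exp (-lam * τ) ^ i := by
    intro k
    induction k with
    | zero =>
      intro s r hs hr hrτ
      have h := hshort s r hs hr hrτ
      simp only [Nat.cast_zero, zero_mul, add_zero, zero_add, Finset.sum_range_one, pow_zero,
        mul_one]
      nlinarith
    | succ k ih =>
      intro s r hs hr hrτ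
      have hkτ : 0 ≤ ((k + 1 : ℕ) : ℝ) * τ := by positivity
      rw [hpN_add r _ hr hkτ, hpbar_add r _ hr hkτ, Finset.sum_range_succ, mul_add]
      have hrest := ih (s + r) τ (by positivity) hτ.le le_rfl
      have hlen : τ + (k : ℝ) * τ = ((k + 1 : ℕ) : ℝ) * τ := by push_cast; ring
      rw [hlen, hpbar_add s r hs hr] at hrest
      have hpiece := hcontract (pN r (productMeasure N (pbar s ν)))
        (productMeasure N (pbar r (pbar s ν))) _ hkτ
      have hexp : Real.exp (-lam * (((k + 1 : ℕ) : ℝ) * τ)) =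
          Real.exp (-lam * τ) ^ (k + 1) := by
        rw [← Real.exp_nat_mul]; congr 1; ring
      rw [hexp] at hpiece
      have hpiece' := hpiece.trans
        (mul_le_mul_of_nonneg_left (hshort s r hs hr hrτ) (by positivity))
      have htri := hd_triangle
        (pN (((k + 1 : ℕ) : ℝ) * τ) (pN r (productMeasure N (pbar s ν))))
        (pN (((k + 1 : ℕ) : ℝ) * τ) (productMeasure N (pbar r (pbar s ν))))
        (productMeasure N (pbar (((k + 1 : ℕ) : ℝ) * τ) (pbar r (pbar s ν))))
      linarith
  have hfloor_le : (⌊t / τ⌋₊ : ℝ) * τ ≤ t :=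
    (le_div_iff₀ hτ).1 (Nat.floor_le (div_nonneg ht hτ.le))
  have hlt_floor : t < ((⌊t / τ⌋₊ : ℝ) + 1) * τ :=
    (div_lt_iff₀ hτ).1 (Nat.lt_floor_add_one _)
  have hmain := hgeom ⌊t / τ⌋₊ 0 (t - ⌊t / τ⌋₊ * τ) le_rfl (by linarith) (by linarith)
  rw [sub_add_cancel, hpbar_zero, hd_symm] at hmain
  have hsum : ∑ i ∈ Finset.range (⌊t / τ⌋₊ + 1), Real.exp (-lam * τ) ^ i ≤
      (1 - Real.exp (-lam * τ))⁻¹ := by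
    rw [← tsum_geometric_of_lt_one hq_pos.le hq_lt]
    exact (summable_geometric_of_lt_one hq_pos.le hq_lt).sum_le_tsum _
      fun i _ => pow_nonneg hq_pos.le i
  have hCa : 0 ≤ C * a := mul_nonneg hC ha_nonneg
  calc d (productMeasure N (pbar t ν)) (pN t (productMeasure N ν))
      ≤ C * a * (1 - Real.exp (-lam * τ))⁻¹ :=
        hmain.trans (mul_le_mul_of_nonneg_left hsum hCa)
    _ ≤ 2 * (C * a) * (1 - Real.exp (-lam * τ))⁻¹ :=
        mul_le_mul_of_nonneg_right (by linarith) (inv_nonneg.2 (by linarith))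
    _ = 2 * C * Cν * (N : ℝ) ^ (-α) / (1 - Real.exp (-lam * τ)) := by
        rw [ha, div_eq_mul_inv]; ring
end

section
/- Let 0 ≤ c < 1 and define f : ℝ → ℝ by f(z) = −z − c·cos(sin(z)). Let g : [0,∞) → ℝ be continuous, and let u, v : [0,∞) → ℝ be differentiable functions satisfying u'(t) = f(u(t)) + g(t) and v'(t) = f(v(t)) + g(t) for all t ≥ 0 (two solutions of the same ODE with identical forcing, corresponding to two synchronously coupled copies of the averaged diffusion driven by the same noise). Then for all t ≥ 0, |u(t) − v(t)| ≤ e^{-(1−c)t} · |u(0) − v(0)|. -/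
open Real Set

/-- The drift `z ↦ -z - c cos (sin z)` is one-sided Lipschitz with constant `-(1 - c)`. -/
theorem sub_mul_neg_sub_cos_sin_sub_le {c : ℝ} (hc : 0 ≤ c) (x y : ℝ) :
    (x - y) * ((-x - c * cos (sin x)) - (-y - c * cos (sin y))) ≤ -(1 - c) * (x - y) ^ 2 := by
  have hcos : |cos (sin x) - cos (sin y)| ≤ |x - y| :=
    (abs_cos_sub_cos_le _ _).trans (abs_sin_sub_sin_le _ _)
  have hmul : -((x - y) * (cos (sin x) - cos (sin y))) ≤ (x - y) ^ 2 :=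
    calc -((x - y) * (cos (sin x) - cos (sin y)))
        ≤ |x - y| * |cos (sin x) - cos (sin y)| := by
          rw [← abs_mul]; exact neg_le_abs _
      _ ≤ |x - y| * |x - y| := by gcongr
      _ = (x - y) ^ 2 := by rw [abs_mul_abs_self, sq]
  linarith [mul_le_mul_of_nonneg_left hmul hc]

/-- Grönwall's inequality for a dissipative scalar function: if `w w' ≤ -K w²` on `[0, ∞)`, then
`|w|` decays at exponential rate `K`. -/
theorem abs_le_exp_mul_abs_of_mul_deriv_le {K : ℝ} {w w' : ℝ → ℝ}
    (hw : ∀ t, 0 ≤ t → HasDerivAt w (w' t) t)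
    (hle : ∀ t, 0 ≤ t → w t * w' t ≤ -K * w t ^ 2) {t : ℝ} (ht : 0 ≤ t) :
    |w t| ≤ exp (-K * t) * |w 0| := by
  have hderiv : ∀ s, 0 ≤ s → HasDerivAt (fun s ↦ (exp (K * s) * w s) ^ 2)
      (2 * exp (K * s) ^ 2 * (w s * w' s + K * w s ^ 2)) s := fun s hs ↦ by
    have hexp : HasDerivAt (fun s ↦ exp (K * s)) (exp (K * s) * (K * 1)) s :=
      ((hasDerivAt_id s).const_mul K).exp
    refine ((hexp.mul (hw s hs)).pow 2).congr_deriv ?_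
    simp only [Pi.mul_apply]
    push_cast
    ring
  have hanti : AntitoneOn (fun s ↦ (exp (K * s) * w s) ^ 2) (Ici 0) := by
    refine antitoneOn_of_deriv_nonpos (convex_Ici 0)
      (fun s hs ↦ (hderiv s hs).continuousAt.continuousWithinAt)
      (fun s hs ↦ (hderiv s (interior_subset hs)).differentiableAt.differentiableWithinAt)
      fun s hs ↦ ?_
    have hs' : 0 ≤ s := interior_subset hs
    rw [(hderiv s hs').deriv]
    exact mul_nonpos_of_nonneg_of_nonpos (by positivity) (by linarith [hle s hs'])
  have habs : exp (K * t) * |w t| ≤ |w 0| := by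
    have h := sq_le_sq.mp (hanti self_mem_Ici ht ht)
    simpa [abs_mul] using h
  rw [neg_mul, exp_neg]
  exact (le_inv_mul_iff₀ (exp_pos _)).mpr habs

/-- Synchronous-coupling contraction for the averaged dynamics: two solutions of
`x' = f(x) + g(t)` with `f(z) = -z - c cos(sin z)`, `0 ≤ c < 1`, and the same forcing `g`
contract at exponential rate `1 - c`. -/
theorem synchronous_coupling_contraction
    (c : ℝ) (hc0 : 0 ≤ c) (hc1 : c < 1)
    (f : ℝ → ℝ) (hf : ∀ z : ℝ, f z = -z - c * Real.cos (Real.sin z))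
    (g u v : ℝ → ℝ)
    (hg : ContinuousOn g (Set.Ici (0 : ℝ)))
    (hu : ∀ t : ℝ, 0 ≤ t → HasDerivAt u (f (u t) + g t) t)
    (hv : ∀ t : ℝ, 0 ≤ t → HasDerivAt v (f (v t) + g t) t) :
    ∀ t : ℝ, 0 ≤ t → |u t - v t| ≤ Real.exp (-(1 - c) * t) * |u 0 - v 0| := by
  intro t ht
  refine abs_le_exp_mul_abs_of_mul_deriv_le (w := fun s ↦ u s - v s)
    (fun s hs ↦ (hu s hs).sub (hv s hs)) (fun s _ ↦ ?_) ht
  rw [add_sub_add_right_eq_sub, hf, hf]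
  exact sub_mul_neg_sub_cos_sin_sub_le hc0 (u s) (v s)
end
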